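/- (Greedy with a (1−ε)-approximate incremental oracle under a cardinality constraint.) Let F : 2^E → ℝ be a non-negative monotone submodular function with F(∅) = 0 on a finite ground set E with |E| = n, let 1 ≤ k ≤ n, and let S* maximize F over all subsets of E of size at most k. Let ε ∈ [0, 1]. Suppose S_1 = ∅ and, for j = 1, …, k, S_{j+1} = S_j ∪ {e_j} where e_j ∈ E \ S_j satisfies F_{S_j}(e_j) ≥ (1 − ε)·F_{S_j}(e) for every e ∈ E \ S_j. Then F(S_{k+1}) ≥ (1 − 1/e − ε)·F(S*). -/

import Mathlib

open Finset

def Submodular {E : Type*} [DecidableEq E] (F : Finset E → ℝ) : Prop :=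
  ∀ S T : Finset E, S ⊆ T → ∀ e ∉ T,
    F (insert e T) - F T ≤ F (insert e S) - F S

def MonotoneSetFn {E : Type*} (F : Finset E → ℝ) : Prop :=
  ∀ S T : Finset E, S ⊆ T → F S ≤ F T

theorem Submodular.union_sub_le_sum {E : Type*} [DecidableEq E] {F : Finset E → ℝ}
    (hsub : Submodular F) (hmono : MonotoneSetFn F) (S T : Finset E) :
    F (S ∪ T) - F S ≤ ∑ x ∈ T, (F (insert x S) - F S) := by
  induction T using Finset.induction_on with
  | empty => simp
  | insert x T hx ih =>
    rw [Finset.sum_insert hx, Finset.union_insert]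
    by_cases h : x ∈ S ∪ T
    · rw [Finset.insert_eq_of_mem h]
      linarith [hmono S (insert x S) (Finset.subset_insert x S)]
    · linarith [hsub S (S ∪ T) Finset.subset_union_left x h]

theorem Submodular.mul_gap_le_card_mul {E : Type*} [DecidableEq E] {F : Finset E → ℝ}
    (hsub : Submodular F) (hmono : MonotoneSetFn F) (S T : Finset E) {c d : ℝ}
    (hc : 0 ≤ c) (hd : 0 ≤ d) (h : ∀ x ∉ S, c * (F (insert x S) - F S) ≤ d) :
    c * (F T - F S) ≤ T.card * d := by
  calc c * (F T - F S) ≤ c * ∑ x ∈ T, (F (insert x S) - F S) := by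
        gcongr
        linarith [hsub.union_sub_le_sum hmono S T, hmono T (S ∪ T) Finset.subset_union_right]
    _ = ∑ x ∈ T, c * (F (insert x S) - F S) := Finset.mul_sum _ _ _
    _ ≤ ∑ _x ∈ T, d := by
        refine Finset.sum_le_sum fun x _ => ?_
        by_cases hx : x ∈ S
        · simpa [Finset.insert_eq_of_mem hx] using hd
        · exact h x hx
    _ = T.card * d := by simp

theorem exp_neg_one_sub_le {ε : ℝ} (hε0 : 0 ≤ ε) (hε1 : ε ≤ 1) :
    Real.exp (-(1 - ε)) ≤ 1 / Real.exp 1 + ε := by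
  have h := convexOn_exp.2 (Set.mem_univ (-1)) (Set.mem_univ 0)
    (sub_nonneg.2 hε1) hε0 (sub_add_cancel 1 ε)
  simp only [smul_eq_mul, mul_neg, mul_one, mul_zero, add_zero, Real.exp_zero] at h
  rw [one_div, ← Real.exp_neg]
  nlinarith [Real.exp_pos (-1)]

/-- Greedy with a (1−ε)-approximate incremental oracle, cardinality constraint:
if every chosen element `e_j` satisfies `F_{S_j}(e_j) ≥ (1−ε)·F_{S_j}(e)` for every candidate
`e`, then `F(S_{k+1}) ≥ (1 − 1/e − ε)·F(S*)`. -/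
theorem greedy_multiplicative_oracle_cardinality {E : Type*} [Fintype E] [DecidableEq E]
    (F : Finset E → ℝ)
    (hnonneg : ∀ S, 0 ≤ F S) (hmono : MonotoneSetFn F) (hsub : Submodular F)
    (hempty : F ∅ = 0)
    (k : ℕ) (hk1 : 1 ≤ k) (hkn : k ≤ Fintype.card E)
    (Sstar : Finset E) (hSstar_card : Sstar.card ≤ k)
    (hSstar_opt : ∀ T : Finset E, T.card ≤ k → F T ≤ F Sstar)
    (ε : ℝ) (hε0 : 0 ≤ ε) (hε1 : ε ≤ 1)
    (S : ℕ → Finset E) (e : ℕ → E)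
    (hS1 : S 1 = ∅)
    (hstep : ∀ j, 1 ≤ j → j ≤ k →
      e j ∉ S j ∧ S (j + 1) = insert (e j) (S j) ∧
      ∀ x : E, x ∉ S j →
        F (insert (e j) (S j)) - F (S j) ≥
          (1 - ε) * (F (insert x (S j)) - F (S j))) :
    F (S (k + 1)) ≥ (1 - 1 / Real.exp 1 - ε) * F Sstar := by
  have hk : (0 : ℝ) < k := by exact_mod_cast hk1
  have hratio : (1 - ε) / k ≤ 1 := by
    rw [div_le_one hk]
    linarith [(Nat.one_le_cast (α := ℝ)).2 hk1]
  have hgap : ∀ i ≤ k, F Sstar - F (S (i + 1)) ≤ (1 - (1 - ε) / k) ^ i * F Sstar := by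
    intro i
    induction i with
    | zero => simp [hS1, hempty]
    | succ i ih =>
      intro hi
      obtain ⟨-, hS, hgreedy⟩ := hstep (i + 1) (by omega) hi
      have hgain : 0 ≤ F (insert (e (i + 1)) (S (i + 1))) - F (S (i + 1)) :=
        sub_nonneg.2 (hmono _ _ (Finset.subset_insert _ _))
      have hmul := (hsub.mul_gap_le_card_mul hmono (S (i + 1)) Sstar (sub_nonneg.2 hε1)
        hgain hgreedy).trans
        (mul_le_mul_of_nonneg_right (Nat.cast_le.2 hSstar_card) hgain)
      rw [← hS] at hmul
      have hdiv : (1 - ε) / k * (F Sstar - F (S (i + 1))) ≤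
          F (S (i + 1 + 1)) - F (S (i + 1)) := by
        rw [div_mul_eq_mul_div, div_le_iff₀ hk]
        linarith
      calc F Sstar - F (S (i + 1 + 1))
          ≤ (1 - (1 - ε) / k) * (F Sstar - F (S (i + 1))) := by linarith
        _ ≤ (1 - (1 - ε) / k) * ((1 - (1 - ε) / k) ^ i * F Sstar) :=
            mul_le_mul_of_nonneg_left (ih (by omega)) (sub_nonneg.2 hratio)
        _ = (1 - (1 - ε) / k) ^ (i + 1) * F Sstar := by ring
  have hpow : (1 - (1 - ε) / k) ^ k ≤ 1 / Real.exp 1 + ε :=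
    (Real.one_sub_div_pow_le_exp_neg ((div_le_one hk).1 hratio)).trans
      (exp_neg_one_sub_le hε0 hε1)
  linarith [hgap k le_rfl, mul_le_mul_of_nonneg_right hpow (hnonneg Sstar)]
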